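/- arXiv:1908.00531 — 2 statements merged into one kernel-verified Lean document; each statement's English description precedes it below -/
import Mathlib

section
/- Let n ≥ 2 and let a₁, a₂, …, aₙ be real numbers. Then Σ_{1 ≤ i < j ≤ n} (aᵢ − aⱼ)² ≤ (n / (4·sin²(π/(2n)))) · Σ_{i=1}^{n−1} (aᵢ − a_{i+1})². -/
/-- For `i : Fin (n-1)`, the element `i` of `Fin n`. -/
def lo {n : ℕ} (i : Fin (n - 1)) : Fin n := ⟨i.val, by have := i.isLt; omega⟩

/-- For `i : Fin (n-1)`, the element `i+1` of `Fin n`. -/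
def hi {n : ℕ} (i : Fin (n - 1)) : Fin n := ⟨i.val + 1, by have := i.isLt; omega⟩

/-- The sum over ordered pairs `i < j` of squared differences is the Lagrange expression
`n ∑ aᵢ² - (∑ aᵢ)²`. -/
theorem sum_lt_sub_sq {n : ℕ} (a : Fin n → ℝ) :
    ∑ p ∈ Finset.univ.filter (fun p : Fin n × Fin n => p.1 < p.2), (a p.1 - a p.2) ^ 2 =
      n * ∑ i, a i ^ 2 - (∑ i, a i) ^ 2 := by
  have hall : ∑ i, ∑ j, (a i - a j) ^ 2 = 2 * (n * ∑ i, a i ^ 2 - (∑ i, a i) ^ 2) := by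
    simp only [sub_sq, Finset.sum_add_distrib, Finset.sum_sub_distrib, ← Finset.mul_sum,
      ← Finset.sum_mul, Finset.sum_const, Finset.card_univ, Fintype.card_fin, nsmul_eq_mul]
    ring
  have hsymm : ∑ i, ∑ j, (if j < i then (a i - a j) ^ 2 else 0) =
      ∑ i, ∑ j, (if i < j then (a i - a j) ^ 2 else 0) := by
    rw [Finset.sum_comm]
    simp only [sub_sq_comm]
  have hsplit : ∑ i, ∑ j, (a i - a j) ^ 2 =
      ∑ i, ∑ j, (if i < j then (a i - a j) ^ 2 else 0) +
        ∑ i, ∑ j, (if j < i then (a i - a j) ^ 2 else 0) := by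
    simp only [← Finset.sum_add_distrib]
    refine Finset.sum_congr rfl fun i _ => Finset.sum_congr rfl fun j _ => ?_
    rcases lt_trichotomy i j with h | h | h
    · simp [h, h.not_gt]
    · simp [h]
    · simp [h, h.not_gt]
  rw [Finset.sum_filter, Fintype.sum_prod_type]
  linarith

theorem sum_sq_eq_sub_sum_mul_partialSum (b : ℕ → ℝ) (N : ℕ) :
    ∑ i ∈ Finset.range (N + 1), b i ^ 2 =
      b N * ∑ i ∈ Finset.range (N + 1), b i -
        ∑ i ∈ Finset.range N, (b (i + 1) - b i) * ∑ j ∈ Finset.range (i + 1), b j := by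
  induction N with
  | zero => simp [sq]
  | succ N ih =>
    rw [Finset.sum_range_succ, ih,
      Finset.sum_range_succ (fun i => (b (i + 1) - b i) * ∑ j ∈ Finset.range (i + 1), b j) N,
      Finset.sum_range_succ b (N + 1), Finset.sum_range_succ b N]
    ring

theorem sin_nat_mul_pi_div_pos {n m : ℕ} (hm : 0 < m) (hmn : m < n) :
    0 < Real.sin (m * (Real.pi / n)) := by
  have hn : (0 : ℝ) < n := by exact_mod_cast hm.trans hmn
  have h₁ : (m : ℝ) < n := by exact_mod_cast hmn
  apply Real.sin_pos_of_pos_of_lt_pi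
  · have : (0 : ℝ) < m := by exact_mod_cast hm
    positivity
  · rw [mul_div_assoc', div_lt_iff₀ hn]
    nlinarith [Real.pi_pos]

theorem sin_add_two_mul (θ : ℝ) (m : ℕ) :
    Real.sin (m * θ) =
      2 * Real.cos θ * Real.sin ((m + 1 : ℕ) * θ) - Real.sin ((m + 2 : ℕ) * θ) := by
  have h₁ : (m : ℝ) * θ = (m + 1 : ℕ) * θ - θ := by push_cast; ring
  have h₂ : ((m + 2 : ℕ) : ℝ) * θ = (m + 1 : ℕ) * θ + θ := by push_cast; ring
  rw [h₁, h₂, Real.sin_sub, Real.sin_add]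
  ring

/-- Lower bound for the partial Dirichlet energies, with the positive ground state
`k ↦ sin (kπ/n)` of the path with Dirichlet boundary conditions. -/
theorem partial_dirichlet_energy_bound {n : ℕ} (u : ℕ → ℝ) (h₀ : u 0 = 0) (m : ℕ)
    (hm : m + 1 < n) :
    u (m + 1) ^ 2 *
        (1 - Real.sin (m * (Real.pi / n)) / Real.sin ((m + 1 : ℕ) * (Real.pi / n))) ≤
      ∑ k ∈ Finset.range (m + 1), (u (k + 1) - u k) ^ 2 -
        (2 - 2 * Real.cos (Real.pi / n)) * ∑ k ∈ Finset.range m, u (k + 1) ^ 2 := by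
  induction m with
  | zero => simp [h₀]
  | succ m ih =>
    have ih := ih (by omega)
    have hx := sin_nat_mul_pi_div_pos (Nat.succ_pos m) (by omega : m + 1 < n)
    have hy := sin_nat_mul_pi_div_pos (Nat.succ_pos (m + 1)) hm
    rw [sin_add_two_mul] at ih
    rw [Finset.sum_range_succ _ (m + 1), Finset.sum_range_succ (fun k => u (k + 1) ^ 2) m]
    simp only [Nat.succ_eq_add_one, add_assoc, Nat.reduceAdd] at *
    set x := Real.sin ((m + 1 : ℕ) * (Real.pi / n))
    set y := Real.sin ((m + 2 : ℕ) * (Real.pi / n))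
    set c := Real.cos (Real.pi / n)
    have key : 0 ≤ x * y * (u (m + 2) / y - u (m + 1) / x) ^ 2 := by positivity
    have e₁ : x * y * (u (m + 2) / y - u (m + 1) / x) ^ 2 =
        u (m + 2) ^ 2 * (x / y) - 2 * u (m + 2) * u (m + 1) + u (m + 1) ^ 2 * (y / x) := by
      field_simp
      ring
    have e₂ : (2 * c * x - y) / x = 2 * c - y / x := by field_simp
    rw [e₂] at ih
    linarith

/-- The discrete Wirtinger inequality with Dirichlet boundary conditions. -/
theorem dirichlet_poincare {N : ℕ} (hN : 1 ≤ N) (u : ℕ → ℝ) (h₀ : u 0 = 0)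
    (h₁ : u (N + 1) = 0) :
    (2 - 2 * Real.cos (Real.pi / (N + 1 : ℕ))) * ∑ k ∈ Finset.range N, u (k + 1) ^ 2 ≤
      ∑ k ∈ Finset.range (N + 1), (u (k + 1) - u k) ^ 2 := by
  obtain ⟨m, rfl⟩ : ∃ m, N = m + 1 := ⟨N - 1, by omega⟩
  have h := partial_dirichlet_energy_bound (n := m + 1 + 1) u h₀ m (by omega)
  have hx := sin_nat_mul_pi_div_pos (Nat.succ_pos m) (by omega : m + 1 < m + 1 + 1)
  have hπ : Real.sin ((m + 2 : ℕ) * (Real.pi / (m + 1 + 1 : ℕ))) = 0 := by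
    rw [mul_div_cancel₀ _ (by positivity), Real.sin_pi]
  rw [sin_add_two_mul, hπ, sub_zero, mul_div_cancel_right₀ _ hx.ne'] at h
  rw [Finset.sum_range_succ _ (m + 1), Finset.sum_range_succ (fun k => u (k + 1) ^ 2) m, h₁]
  linarith

/-- The discrete Wirtinger inequality for sequences of mean zero. -/
theorem neumann_poincare {N : ℕ} (hN : 1 ≤ N) (b : ℕ → ℝ)
    (hb : ∑ i ∈ Finset.range (N + 1), b i = 0) :
    (2 - 2 * Real.cos (Real.pi / (N + 1 : ℕ))) * ∑ i ∈ Finset.range (N + 1), b i ^ 2 ≤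
      ∑ i ∈ Finset.range N, (b i - b (i + 1)) ^ 2 := by
  have hD := dirichlet_poincare hN (fun k => ∑ j ∈ Finset.range k, b j) (by simp) hb
  have hP := sum_sq_eq_sub_sum_mul_partialSum b N
  have hc := Real.cos_le_one (Real.pi / (N + 1 : ℕ))
  simp only [Finset.sum_range_succ_sub_sum] at hD
  rw [hb, mul_zero, zero_sub] at hP
  set l := 2 - 2 * Real.cos (Real.pi / (N + 1 : ℕ))
  have hl : 0 ≤ l := by simp only [l]; linarith
  have hsq : 0 ≤ ∑ i ∈ Finset.range N,
      ((b (i + 1) - b i) + l * ∑ j ∈ Finset.range (i + 1), b j) ^ 2 :=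
    Finset.sum_nonneg fun i _ => sq_nonneg _
  have hexp : ∑ i ∈ Finset.range N,
      ((b (i + 1) - b i) + l * ∑ j ∈ Finset.range (i + 1), b j) ^ 2 =
      ∑ i ∈ Finset.range N, (b i - b (i + 1)) ^ 2 +
        2 * l * ∑ i ∈ Finset.range N, (b (i + 1) - b i) * ∑ j ∈ Finset.range (i + 1), b j +
        l * (l * ∑ i ∈ Finset.range N, (∑ j ∈ Finset.range (i + 1), b j) ^ 2) := by
    simp only [Finset.mul_sum (Finset.range N), ← Finset.sum_add_distrib]
    exact Finset.sum_congr rfl fun i _ => by ring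
  have := mul_le_mul_of_nonneg_left hD hl
  have hP' : ∑ i ∈ Finset.range N, (b (i + 1) - b i) * ∑ j ∈ Finset.range (i + 1), b j =
      -∑ i ∈ Finset.range (N + 1), b i ^ 2 := by linarith
  rw [hexp, hP'] at hsq
  linarith

theorem stmt17 {n : ℕ} (hn : 2 ≤ n) (a : Fin n → ℝ) :
    ∑ p ∈ Finset.univ.filter (fun p : Fin n × Fin n => p.1 < p.2), (a p.1 - a p.2) ^ 2 ≤
      ((n : ℝ) / (4 * Real.sin (Real.pi / (2 * n)) ^ 2)) *
        ∑ i : Fin (n - 1), (a (lo i) - a (hi i)) ^ 2 := by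
  obtain ⟨N, rfl⟩ : ∃ N, n = N + 1 := ⟨n - 1, by omega⟩
  have hn₀ : (0 : ℝ) < (N + 1 : ℕ) := by positivity
  have hsin : 0 < Real.sin (Real.pi / (2 * (N + 1 : ℕ))) := by
    have := sin_nat_mul_pi_div_pos one_pos (by omega : 1 < 2 * (N + 1))
    simpa using this
  have hcos : 2 - 2 * Real.cos (Real.pi / (N + 1 : ℕ)) =
      4 * Real.sin (Real.pi / (2 * (N + 1 : ℕ))) ^ 2 := by
    have : Real.pi / (N + 1 : ℕ) = 2 * (Real.pi / (2 * (N + 1 : ℕ))) := by field_simp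
    rw [this, Real.cos_two_mul, Real.cos_sq']
    ring
  set s := ∑ i, a i with hs
  let b : ℕ → ℝ := fun k => (if h : k < N + 1 then a ⟨k, h⟩ else 0) - s / (N + 1 : ℕ)
  have hb (i : Fin (N + 1)) : b i = a i - s / (N + 1 : ℕ) := by simp only [b, i.isLt, dite_true]
  have hsum : ∑ i ∈ Finset.range (N + 1), b i = 0 := by
    rw [← Fin.sum_univ_eq_sum_range]
    simp only [hb, Finset.sum_sub_distrib, Finset.sum_const, Finset.card_univ, Fintype.card_fin,
      nsmul_eq_mul, ← hs]
    field_simp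
    ring
  have hsumsq : (N + 1 : ℕ) * ∑ i ∈ Finset.range (N + 1), b i ^ 2 =
      (N + 1 : ℕ) * ∑ i, a i ^ 2 - s ^ 2 := by
    rw [← Fin.sum_univ_eq_sum_range (fun i => b i ^ 2)]
    simp only [hb, sub_sq, Finset.sum_add_distrib, Finset.sum_sub_distrib, ← Finset.mul_sum,
      ← Finset.sum_mul, Finset.sum_const, Finset.card_univ, Fintype.card_fin, nsmul_eq_mul, ← hs]
    field_simp
    ring
  have hdiff : ∑ i : Fin (N + 1 - 1), (a (lo i) - a (hi i)) ^ 2 =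
      ∑ i ∈ Finset.range N, (b i - b (i + 1)) ^ 2 := by
    rw [← Fin.sum_univ_eq_sum_range (fun i => (b i - b (i + 1)) ^ 2)]
    refine Finset.sum_congr rfl fun i _ => ?_
    have h₁ : b i = _ := hb (lo i)
    have h₂ : b (i + 1) = _ := hb (hi i)
    rw [h₁, h₂]
    ring
  have hmain := neumann_poincare (by omega : 1 ≤ N) b hsum
  rw [hcos] at hmain
  rw [sum_lt_sub_sq, ← hs, ← hsumsq, hdiff, div_mul_eq_mul_div, le_div_iff₀ (by positivity)]
  have := mul_le_mul_of_nonneg_left hmain hn₀.le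
  linarith
end

section
/- Let n ≥ 2, let H be a complex Hilbert space, and let v₁, v₂, …, vₙ ∈ H. Then Σ_{1 ≤ i < j ≤ n} ‖vᵢ − vⱼ‖² ≤ (n / (4·sin²(π/(2n)))) · Σ_{i=1}^{n−1} ‖vᵢ − v_{i+1}‖². -/
theorem two_mul_sin_mul_sum_cos_odd (θ : ℝ) (m : ℕ) :
    2 * Real.sin θ * ∑ i ∈ Finset.range m, Real.cos ((2 * i + 1) * θ) =
      Real.sin (2 * m * θ) := by
  induction m with
  | zero => simp
  | succ m ih =>
    rw [Finset.sum_range_succ, mul_add, ih]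
    have h1 : 2 * (m : ℝ) * θ = (2 * m + 1) * θ - θ := by ring
    have h2 : 2 * ((m + 1 : ℕ) : ℝ) * θ = (2 * m + 1) * θ + θ := by push_cast; ring
    rw [h1, h2, Real.sin_sub, Real.sin_add]
    ring

theorem cos_odd_sub_cos_odd_succ (θ : ℝ) (k : ℕ) :
    Real.cos ((2 * k + 1) * θ) - Real.cos ((2 * (k + 1 : ℕ) + 1) * θ) =
      2 * Real.sin θ * Real.sin (2 * (k + 1 : ℕ) * θ) := by
  have h1 : (2 * (k : ℝ) + 1) * θ = 2 * (k + 1 : ℕ) * θ - θ := by push_cast; ring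
  have h2 : (2 * ((k + 1 : ℕ) : ℝ) + 1) * θ = 2 * (k + 1 : ℕ) * θ + θ := by ring
  rw [h1, h2, Real.cos_sub, Real.cos_add]
  ring

/-- Weighted Cauchy–Schwarz along a path, with weights the increments of a strictly decreasing
sequence `a`. -/
theorem norm_sub_sq_le_mul_sum_div {E : Type*} [SeminormedAddCommGroup E] (u : ℕ → E) (a : ℕ → ℝ)
    {i j : ℕ} (hij : i < j) (ha : ∀ k ∈ Finset.Ico i j, 0 < a k - a (k + 1)) :
    ‖u i - u j‖ ^ 2 ≤
      (a i - a j) * ∑ k ∈ Finset.Ico i j, ‖u k - u (k + 1)‖ ^ 2 / (a k - a (k + 1)) := by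
  have htel : ∑ k ∈ Finset.Ico i j, (a k - a (k + 1)) = a i - a j := by
    have := Finset.sum_Ico_sub a hij.le
    rw [← neg_sub (a j), ← this, ← Finset.sum_neg_distrib]
    simp
  have hpos : 0 < a i - a j :=
    htel ▸ Finset.sum_pos ha (Finset.nonempty_Ico.2 hij)
  have hcs := Finset.sq_sum_div_le_sum_sq_div (Finset.Ico i j) (fun k ↦ ‖u k - u (k + 1)‖) ha
  rw [htel, div_le_iff₀' hpos] at hcs
  refine le_trans ?_ hcs
  have := dist_le_Ico_sum_dist u hij.le
  simp only [dist_eq_norm] at this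
  gcongr

theorem sum_pairs_mul_sum_Ico (n : ℕ) (g : ℕ → ℕ → ℝ) (c : ℕ → ℝ) :
    ∑ j ∈ Finset.range n, ∑ i ∈ Finset.range j, g i j * ∑ k ∈ Finset.Ico i j, c k =
      ∑ k ∈ Finset.range (n - 1),
        (∑ j ∈ Finset.Ico (k + 1) n, ∑ i ∈ Finset.range (k + 1), g i j) * c k := by
  have hinner (j : ℕ) : ∑ i ∈ Finset.range j, g i j * ∑ k ∈ Finset.Ico i j, c k =
      ∑ k ∈ Finset.range j, ∑ i ∈ Finset.range (k + 1), g i j * c k := by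
    simp only [Finset.mul_sum]
    exact Finset.sum_comm' fun i k ↦ by simp only [Finset.mem_range, Finset.mem_Ico]; omega
  simp only [hinner, Finset.sum_mul]
  exact Finset.sum_comm' fun j k ↦ by simp only [Finset.mem_range, Finset.mem_Ico]; omega

/-- If `a` sums to zero on `range n`, then the sum of `a i - a j` over all pairs separated by `m`
is `n` times the partial sum of `a` up to `m`. -/
theorem sum_Ico_sum_range_sub (a : ℕ → ℝ) {m n : ℕ} (hmn : m ≤ n)
    (ha : ∑ i ∈ Finset.range n, a i = 0) :
    ∑ j ∈ Finset.Ico m n, ∑ i ∈ Finset.range m, (a i - a j) =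
      n * ∑ i ∈ Finset.range m, a i := by
  have htail : ∑ j ∈ Finset.Ico m n, a j = -∑ i ∈ Finset.range m, a i := by
    rw [Finset.sum_Ico_eq_sub _ hmn, ha, zero_sub]
  simp only [Finset.sum_sub_distrib, Finset.sum_const, Finset.card_range, Nat.card_Ico,
    nsmul_eq_mul, ← Finset.mul_sum, htail, Nat.cast_sub hmn]
  ring

theorem sum_range_norm_sub_sq_le {E : Type*} [SeminormedAddCommGroup E] {n : ℕ} (hn : 2 ≤ n)
    (u : ℕ → E) :
    ∑ j ∈ Finset.range n, ∑ i ∈ Finset.range j, ‖u i - u j‖ ^ 2 ≤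
      ((n : ℝ) / (4 * Real.sin (Real.pi / (2 * n)) ^ 2)) *
        ∑ k ∈ Finset.range (n - 1), ‖u k - u (k + 1)‖ ^ 2 := by
  have hn0 : (0 : ℝ) < n := by exact_mod_cast (by omega : 0 < n)
  set θ := Real.pi / (2 * n) with hθ
  have hnθ : 2 * n * θ = Real.pi := by rw [hθ]; field_simp
  have hθ0 : 0 < θ := by positivity
  have hsin {m : ℕ} (h0 : 0 < m) (hm : m < n) : 0 < Real.sin (2 * m * θ) := by
    have : (m : ℝ) < n := by exact_mod_cast hm
    have : (0 : ℝ) < m := by exact_mod_cast h0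
    refine Real.sin_pos_of_pos_of_lt_pi (by positivity) ?_
    rw [← hnθ]
    gcongr
  have hsθ : 0 < Real.sin θ := by
    refine Real.sin_pos_of_pos_of_lt_pi hθ0 ?_
    have : (2 : ℝ) ≤ n := by exact_mod_cast hn
    nlinarith
  set a : ℕ → ℝ := fun i ↦ Real.cos ((2 * i + 1) * θ) with ha
  have hdiff (k : ℕ) : a k - a (k + 1) = 2 * Real.sin θ * Real.sin (2 * (k + 1 : ℕ) * θ) :=
    cos_odd_sub_cos_odd_succ θ k
  have hpos {k : ℕ} (hk : k + 1 < n) : 0 < a k - a (k + 1) := by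
    rw [hdiff]
    have := hsin k.succ_pos hk
    positivity
  have hzero : ∑ i ∈ Finset.range n, a i = 0 := by
    have := two_mul_sin_mul_sum_cos_odd θ n
    rw [hnθ, Real.sin_pi] at this
    exact (mul_eq_zero.1 this).resolve_left (by positivity)
  calc ∑ j ∈ Finset.range n, ∑ i ∈ Finset.range j, ‖u i - u j‖ ^ 2
      ≤ ∑ j ∈ Finset.range n, ∑ i ∈ Finset.range j,
          (a i - a j) * ∑ k ∈ Finset.Ico i j, ‖u k - u (k + 1)‖ ^ 2 / (a k - a (k + 1)) := by
        refine Finset.sum_le_sum fun j hj ↦ Finset.sum_le_sum fun i hi ↦ ?_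
        rw [Finset.mem_range] at hi hj
        refine norm_sub_sq_le_mul_sum_div u a hi fun k hk ↦ hpos ?_
        rw [Finset.mem_Ico] at hk
        omega
    _ = ∑ k ∈ Finset.range (n - 1),
          (n / (4 * Real.sin θ ^ 2)) * ‖u k - u (k + 1)‖ ^ 2 := by
        rw [sum_pairs_mul_sum_Ico n (fun i j ↦ a i - a j)]
        refine Finset.sum_congr rfl fun k hk ↦ ?_
        rw [Finset.mem_range] at hk
        have hk' : k + 1 < n := by omega
        rw [sum_Ico_sum_range_sub a hk'.le hzero, hdiff,
          ← two_mul_sin_mul_sum_cos_odd θ (k + 1)]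
        have hS : ∑ i ∈ Finset.range (k + 1), a i ≠ 0 := by
          intro h
          have h1 := two_mul_sin_mul_sum_cos_odd θ (k + 1)
          have h2 := hsin k.succ_pos hk'
          rw [h, mul_zero] at h1
          exact h2.ne h1
        change _ * (_ / (_ * (_ * ∑ i ∈ Finset.range (k + 1), a i))) = _
        field_simp
        ring
    _ = _ := by rw [Finset.mul_sum]

theorem Fin.sum_filter_fst_lt_snd {M : Type*} [AddCommMonoid M] (n : ℕ) (g : ℕ → ℕ → M) :
    ∑ p ∈ Finset.univ.filter (fun p : Fin n × Fin n => p.1 < p.2), g p.1 p.2 =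
      ∑ j ∈ Finset.range n, ∑ i ∈ Finset.range j, g i j := by
  rw [Finset.sum_filter, Fintype.sum_prod_type_right]
  simp only [Fin.lt_def]
  rw [← Fin.sum_univ_eq_sum_range (fun j ↦ ∑ i ∈ Finset.range j, g i j)]
  refine Finset.sum_congr rfl fun j _ ↦ ?_
  rw [Fin.sum_univ_eq_sum_range (fun i ↦ if i < (j : ℕ) then g i j else 0), ← Finset.sum_filter]
  congr 1
  ext i
  simp only [Finset.mem_filter, Finset.mem_range]
  omega

theorem stmt18 {n : ℕ} (hn : 2 ≤ n)
    {H : Type*} [NormedAddCommGroup H] [InnerProductSpace ℂ H]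
    (v : Fin n → H) :
    ∑ p ∈ Finset.univ.filter (fun p : Fin n × Fin n => p.1 < p.2), ‖v p.1 - v p.2‖ ^ 2 ≤
      ((n : ℝ) / (4 * Real.sin (Real.pi / (2 * n)) ^ 2)) *
        ∑ i : Fin (n - 1), ‖v (lo i) - v (hi i)‖ ^ 2 := by
  obtain ⟨u, hu⟩ : ∃ u : ℕ → H, ∀ i : Fin n, v i = u i :=
    ⟨fun k ↦ if h : k < n then v ⟨k, h⟩ else 0, fun i ↦ by simp⟩
  simp only [hu, lo, hi]
  rw [Fin.sum_filter_fst_lt_snd n (fun i j ↦ ‖u i - u j‖ ^ 2),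
    Fin.sum_univ_eq_sum_range (fun k ↦ ‖u k - u (k + 1)‖ ^ 2)]
  exact sum_range_norm_sub_sq_le hn u
end
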